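/- For every real number α, sin α − sin 2α − 2·sin 4α = −(2·cos α + 1)·(8·cos²α − 4·cos α − 1)·sin α. Moreover, if a and α are real numbers with a > 0 and π/2 < α < 3π/4 such that a + e^{i(π−α)} + e^{i(2π−2α)} + e^{iπ} + e^{i(4π−4α)} + e^{i(−π+4α)} = 0 in ℂ, then either cos α = −1/2 and a = 1, or cos α = (1 − √3)/4 and a = 7/4. -/

import Mathlib

/-- The quadruple-angle formula for the sine, in terms of `sin x` and `cos x`. -/
theorem Real.sin_four_mul_eq (x : ℝ) :
    Real.sin (4 * x) = 4 * Real.sin x * Real.cos x * (2 * Real.cos x ^ 2 - 1) := by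
  rw [show 4 * x = 2 * (2 * x) by ring, Real.sin_two_mul, Real.sin_two_mul, Real.cos_two_mul]
  ring

theorem Real.sin_sub_sin_two_mul_sub_two_mul_sin_four_mul (x : ℝ) :
    Real.sin x - Real.sin (2 * x) - 2 * Real.sin (4 * x) =
      -((2 * Real.cos x + 1) * (8 * Real.cos x ^ 2 - 4 * Real.cos x - 1) * Real.sin x) := by
  rw [Real.sin_four_mul_eq, Real.sin_two_mul]
  ring

theorem Complex.exp_I_mul_ofReal (x : ℝ) :
    Complex.exp (Complex.I * (x : ℂ)) = ⟨Real.cos x, Real.sin x⟩ := by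
  rw [mul_comm]
  exact Complex.ext (Complex.exp_ofReal_mul_I_re x) (Complex.exp_ofReal_mul_I_im x)


theorem stmt18 :
    (∀ α : ℝ, Real.sin α - Real.sin (2 * α) - 2 * Real.sin (4 * α) =
      -((2 * Real.cos α + 1) * (8 * Real.cos α ^ 2 - 4 * Real.cos α - 1) *
        Real.sin α)) ∧
    (∀ a α : ℝ, 0 < a → Real.pi / 2 < α → α < 3 * Real.pi / 4 →
      (a : ℂ) + Complex.exp (Complex.I * ((Real.pi - α : ℝ) : ℂ)) +
          Complex.exp (Complex.I * ((2 * Real.pi - 2 * α : ℝ) : ℂ)) +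
          Complex.exp (Complex.I * ((Real.pi : ℝ) : ℂ)) +
          Complex.exp (Complex.I * ((4 * Real.pi - 4 * α : ℝ) : ℂ)) +
          Complex.exp (Complex.I * ((-Real.pi + 4 * α : ℝ) : ℂ)) = 0 →
      (Real.cos α = -(1 / 2) ∧ a = 1) ∨
      (Real.cos α = (1 - Real.sqrt 3) / 4 ∧ a = 7 / 4)) := by
  refine ⟨Real.sin_sub_sin_two_mul_sub_two_mul_sin_four_mul, fun a α _ hα₁ hα₂ h => ?_⟩
  have hs : 0 < Real.sin α := Real.sin_pos_of_pos_of_lt_pi (by linarith [Real.pi_pos])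
    (by linarith [Real.pi_pos])
  have hc : Real.cos α < 0 := Real.cos_neg_of_pi_div_two_lt_of_lt hα₁ (by linarith [Real.pi_pos])
  have h_four : 4 * Real.pi - 4 * α = 2 * Real.pi - 4 * α + 2 * Real.pi := by ring
  have h_neg : -Real.pi + 4 * α = 4 * α - Real.pi := by ring
  simp only [Complex.exp_I_mul_ofReal] at h
  have h_re := congrArg Complex.re h
  have h_im := congrArg Complex.im h
  simp only [Complex.add_re, Complex.ofReal_re, Complex.zero_re, h_four, h_neg,
    Real.cos_add_two_pi, Real.cos_pi_sub, Real.cos_two_pi_sub, Real.cos_sub_pi, Real.cos_pi,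
    Real.cos_two_mul] at h_re
  simp only [Complex.add_im, Complex.ofReal_im, Complex.zero_im, h_four, h_neg,
    Real.sin_add_two_pi, Real.sin_pi_sub, Real.sin_two_pi_sub, Real.sin_sub_pi,
    Real.sin_pi] at h_im
  have h_prod : (2 * Real.cos α + 1) * (8 * Real.cos α ^ 2 - 4 * Real.cos α - 1) *
      Real.sin α = 0 := by
    linarith [Real.sin_sub_sin_two_mul_sub_two_mul_sin_four_mul α]
  rcases mul_eq_zero.mp ((mul_eq_zero.mp h_prod).resolve_right hs.ne') with h_lin | h_quad
  · have hcos : Real.cos α = -(1 / 2) := by linarith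
    rw [hcos] at h_re
    exact Or.inl ⟨hcos, by linarith⟩
  · have h_sqrt : Real.sqrt 3 = 1 - 4 * Real.cos α := by
      rw [Real.sqrt_eq_iff_mul_self_eq (by norm_num) (by linarith)]
      linarith
    exact Or.inr ⟨by linarith, by linarith⟩
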